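/- Let ω : X → ℝ be a model with a ≤ ω(z) ≤ b for all z ∈ X, restrict all labels to [a,b], and for a dataset (x,y) ∈ (X × [a,b])^n with n ≥ 1 define MSE_ω(x,y) = (1/n)·Σ_{i=1}^n (ω(x_i) − y_i)². For 0 ≤ ℓ ≤ n define Ū^ℓ(x,y) = ( ℓ·(b−a)² + max{ Σ_{i∈S} (ω(x_i) − y_i)² : S ⊆ {1,…,n}, |S| = n−ℓ } ) / n. Then for every 0 ≤ ℓ ≤ n, Ū^ℓ(x,y) ≥ sup{ MSE_ω(x',y') : (x',y') ∈ (X × [a,b])^n, d_ham((x,y),(x',y')) ≤ ℓ }, and for every 0 ≤ ℓ < n and every neighboring dataset (x',y') ∈ (X × [a,b])^n, Ū^ℓ(x,y) ≤ Ū^{ℓ+1}(x',y'). -/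

import Mathlib

open scoped Classical

/-- Hamming distance between two datasets. -/
noncomputable def hdist {n : ℕ} {X : Type*} (x x' : Fin n → X) : ℕ :=
  (Finset.univ.filter fun i => x i ≠ x' i).card

/-- The per-example squared error of model `ω` on example `(x_i, y_i)`. -/
noncomputable def sqLoss {X : Type*} (ω : X → ℝ) (p : X × ℝ) : ℝ :=
  (ω p.1 - p.2) ^ 2

/-- The mean squared error of model `ω` on a dataset of `n` labeled examples. -/
noncomputable def MSE {X : Type*} {n : ℕ} (ω : X → ℝ) (d : Fin n → X × ℝ) : ℝ :=
  (∑ i, sqLoss ω (d i)) / n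

/-- The approximate upper bounding function
`Ū^ℓ(x,y) = (ℓ·(b−a)² + max{ Σ_{i∈S} (ω(x_i)−y_i)² : |S| = n−ℓ })/n`. -/
noncomputable def UbarMSE {X : Type*} {n : ℕ} (ω : X → ℝ) (a b : ℝ) (ℓ : ℕ)
    (d : Fin n → X × ℝ) : ℝ :=
  (ℓ * (b - a) ^ 2 +
    (Finset.univ.powersetCard (n - ℓ)).sup'
      (Finset.powersetCard_nonempty.mpr (by simp [Nat.sub_le]))
      (fun S => ∑ i ∈ S, sqLoss ω (d i))) / n

/-- The squared error is at most `(b - a) ^ 2` when output and label lie in `[a, b]`. -/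
lemma sqLoss_le_sq {X : Type*} {ω : X → ℝ} {a b : ℝ} (hω : ∀ z, a ≤ ω z ∧ ω z ≤ b)
    {p : X × ℝ} (hp : p.2 ∈ Set.Icc a b) : sqLoss ω p ≤ (b - a) ^ 2 := by
  obtain ⟨h₁, h₂⟩ := hω p.1
  obtain ⟨h₃, h₄⟩ := hp
  exact sq_le_sq' (by linarith) (by linarith)

lemma hdist_comm {n : ℕ} {X : Type*} (x x' : Fin n → X) : hdist x x' = hdist x' x := by
  simp only [hdist, ne_comm]

/-- Discarding `k` indices, including those where `d` and `d'` differ, costs at most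
`k * (b - a) ^ 2`. -/
lemma exists_card_eq_sum_sqLoss_le {X : Type*} {n : ℕ} {ω : X → ℝ} {a b : ℝ}
    (hω : ∀ z, a ≤ ω z ∧ ω z ≤ b) {d d' : Fin n → X × ℝ}
    (hd : ∀ i, (d i).2 ∈ Set.Icc a b) {k : ℕ} (hk : hdist d d' ≤ k)
    (T : Finset (Fin n)) (hT : k ≤ T.card) :
    ∃ S : Finset (Fin n), S.card = T.card - k ∧
      ∑ i ∈ T, sqLoss ω (d i) ≤ k * (b - a) ^ 2 + ∑ i ∈ S, sqLoss ω (d' i) := by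
  have hcard : T.card - k ≤ (T \ Finset.univ.filter fun i => d i ≠ d' i).card := by
    refine (Nat.sub_le_sub_left hk _).trans (le_of_eq_of_le ?_ (Finset.le_card_sdiff _ _))
    unfold hdist
    congr!
  obtain ⟨S, hS, hSc⟩ := Finset.exists_subset_card_eq hcard
  have hST : S ⊆ T := hS.trans Finset.sdiff_subset
  refine ⟨S, hSc, ?_⟩
  rw [← Finset.sum_sdiff hST]
  refine add_le_add ?_ (Finset.sum_le_sum fun i hi => ?_)
  · have hc : (T \ S).card = k := by
      rw [Finset.card_sdiff_of_subset hST]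
      omega
    have := Finset.sum_le_card_nsmul (T \ S) (fun i => sqLoss ω (d i)) ((b - a) ^ 2)
      fun i _ => sqLoss_le_sq hω (hd i)
    rwa [hc, nsmul_eq_mul] at this
  · have h := hS hi
    simp only [Finset.mem_sdiff, Finset.mem_filter, Finset.mem_univ, true_and, not_not] at h
    rw [h.2]

/-- For a model with outputs in `[a,b]` and labels restricted to `[a,b]`, the
functions `Ū^ℓ` are valid approximate upper sensitivity bounding functions for the
mean squared error. -/
theorem stmt19 {X : Type*} {n : ℕ} (hn : 1 ≤ n) (ω : X → ℝ) (a b : ℝ)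
    (hab : a ≤ b) (hω : ∀ z, a ≤ ω z ∧ ω z ≤ b) :
    (∀ ℓ ≤ n, ∀ d : Fin n → X × ℝ, (∀ i, (d i).2 ∈ Set.Icc a b) →
        sSup (MSE ω '' {d' : Fin n → X × ℝ |
            (∀ i, (d' i).2 ∈ Set.Icc a b) ∧ hdist d d' ≤ ℓ})
          ≤ UbarMSE ω a b ℓ d) ∧
      (∀ ℓ < n, ∀ d d' : Fin n → X × ℝ, (∀ i, (d i).2 ∈ Set.Icc a b) →
        (∀ i, (d' i).2 ∈ Set.Icc a b) → hdist d d' ≤ 1 →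
        UbarMSE ω a b ℓ d ≤ UbarMSE ω a b (ℓ + 1) d') := by
  constructor
  · intro ℓ hℓ d hd
    refine csSup_le ⟨_, d, ⟨hd, by simp [hdist]⟩, rfl⟩ ?_
    rintro _ ⟨d', ⟨hd', hdd'⟩, rfl⟩
    rw [hdist_comm] at hdd'
    obtain ⟨S, hS, hle⟩ :=
      exists_card_eq_sum_sqLoss_le hω hd' hdd' Finset.univ (by simpa using hℓ)
    rw [Finset.card_univ, Fintype.card_fin] at hS
    unfold MSE UbarMSE
    gcongr
    refine hle.trans ?_
    gcongr
    exact Finset.le_sup' (fun S => ∑ i ∈ S, sqLoss ω (d i))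
      (Finset.mem_powersetCard.mpr ⟨S.subset_univ, hS⟩)
  · intro ℓ hℓ d d' hd _ hdd'
    unfold UbarMSE
    refine div_le_div_of_nonneg_right ?_ n.cast_nonneg
    rw [Nat.cast_add, add_mul, add_assoc]
    gcongr
    refine Finset.sup'_le _ _ fun T hT => ?_
    have hTc := (Finset.mem_powersetCard.mp hT).2
    obtain ⟨S, hS, hle⟩ := exists_card_eq_sum_sqLoss_le hω hd hdd' T (by omega)
    refine hle.trans ?_
    gcongr
    exact Finset.le_sup' (fun S => ∑ i ∈ S, sqLoss ω (d' i))
      (Finset.mem_powersetCard.mpr ⟨S.subset_univ, by omega⟩)
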